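/- Let k > 0 be a real number, let d be a unit vector in three-dimensional Euclidean space ℝ³, and let f, g : ℝ³ → ℂ be functions such that f(x) → 0 and g(x) → 0 as ‖x‖ → ∞ (i.e., along the cocompact filter). Then there is no complex number c such that f(x) + exp(i k ⟨x, d⟩) = c · conj( g(x) + exp(i k ⟨x, d⟩) ) for all x ∈ ℝ³. -/

import Mathlib

open Filter Topology
open scoped RealInnerProductSpace

/-- The second alternative of the phase dichotomy cannot occur: no complex constant
`c` can relate the total field to the conjugate of the other total field. -/
theorem no_conjugate_phase_relation (k : ℝ) (hk : 0 < k)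
    (d : EuclideanSpace ℝ (Fin 3)) (hd : ‖d‖ = 1)
    (f g : EuclideanSpace ℝ (Fin 3) → ℂ)
    (hf : Tendsto f (cocompact (EuclideanSpace ℝ (Fin 3))) (𝓝 0))
    (hg : Tendsto g (cocompact (EuclideanSpace ℝ (Fin 3))) (𝓝 0)) :
    ¬ ∃ c : ℂ, ∀ x : EuclideanSpace ℝ (Fin 3),
      f x + Complex.exp (Complex.I * k * (⟪x, d⟫ : ℝ))
        = c * (starRingEnd ℂ) (g x + Complex.exp (Complex.I * k * (⟪x, d⟫ : ℝ))) := by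
  rintro ⟨c, hc⟩
  have key : ∀ θ : ℝ, Complex.exp (θ * Complex.I)
      = c * (starRingEnd ℂ) (Complex.exp (θ * Complex.I)) := by
    intro θ
    let t : ℕ → ℝ := fun n => (θ + n * (2 * Real.pi)) / k
    have ht : Tendsto t atTop atTop := by
      apply Tendsto.atTop_div_const hk
      apply tendsto_atTop_add_const_left
      exact tendsto_natCast_atTop_atTop.atTop_mul_const (by positivity)
    have hx : Tendsto (fun n => t n • d) atTop (cocompact (EuclideanSpace ℝ (Fin 3))) := by
      rw [← Metric.cobounded_eq_cocompact, ← tendsto_norm_atTop_iff_cobounded]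
      simp only [norm_smul, hd, mul_one]
      exact tendsto_norm_atTop_atTop.comp ht
    have he : ∀ n : ℕ, Complex.exp (Complex.I * k * ((⟪t n • d, d⟫ : ℝ) : ℂ))
        = Complex.exp (θ * Complex.I) := by
      intro n
      have h1 : (⟪t n • d, d⟫ : ℝ) = t n := by
        rw [real_inner_smul_left, real_inner_self_eq_norm_sq, hd]; ring
      rw [h1]
      have h2 : Complex.I * k * (t n : ℂ)
          = θ * Complex.I + n * (2 * Real.pi * Complex.I) := by
        have hk' : (k : ℂ) ≠ 0 := by exact_mod_cast hk.ne'
        simp only [t]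
        push_cast
        field_simp
      rw [h2, Complex.exp_add, Complex.exp_nat_mul_two_pi_mul_I, mul_one]
    have hL : Tendsto (fun n => f (t n • d) + Complex.exp (θ * Complex.I)) atTop
        (𝓝 (0 + Complex.exp (θ * Complex.I))) := (hf.comp hx).add_const _
    have hR : Tendsto (fun n => c * (starRingEnd ℂ) (g (t n • d) + Complex.exp (θ * Complex.I)))
        atTop (𝓝 (c * (starRingEnd ℂ) (0 + Complex.exp (θ * Complex.I)))) :=
      ((Complex.continuous_conj.tendsto _).comp ((hg.comp hx).add_const _)).const_mul c
    have hE : (fun n => f (t n • d) + Complex.exp (θ * Complex.I))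
        = fun n => c * (starRingEnd ℂ) (g (t n • d) + Complex.exp (θ * Complex.I)) := by
      funext n
      have := hc (t n • d)
      rwa [he n] at this
    rw [hE] at hL
    simpa using tendsto_nhds_unique hL hR
  have h0 := key 0
  have h1 := key (Real.pi / 2)
  simp at h0
  rw [← h0] at h1
  push_cast at h1
  rw [Complex.exp_pi_div_two_mul_I] at h1
  have := congrArg Complex.im h1
  norm_num at this
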